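/- If 1 ≤ r ≤ n−1, then I_r(M_n) = ⟨D_r(M_n) ∪ D_{r−1}(M_n)⟩. -/

import Mathlib

/-!
Partial Brauer diagrams on `n` points are formalized as set partitions
(equivalence relations, i.e. `Setoid`s) of the vertex set
`{1,…,n} ∪ {1',…,n'}`, encoded as `Fin n ⊕ Fin n`
(`Sum.inl i` is the upper vertex `i`, `Sum.inr i` is the lower vertex `i'`),
all of whose blocks have size at most 2.  The product of two diagrams is
defined via connectivity (paths) in the product graph, and the involution `*`
by interchanging the two rows of vertices.
-/

noncomputable section

open scoped Classical

/-- Vertices of a diagram on `n` points. -/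
abbrev PBV (n : ℕ) := Fin n ⊕ Fin n

/-- A "diagram candidate": an arbitrary set partition of the vertices. -/
abbrev Dgm (n : ℕ) := Setoid (PBV n)

/-- The equivalence relation ("joined by a path") generated by a relation. -/
inductive RGen {V : Type*} (r : V → V → Prop) : V → V → Prop
  | rel {x y : V} : r x y → RGen r x y
  | refl (x : V) : RGen r x x
  | symm {x y : V} : RGen r x y → RGen r y x
  | trans {x y z : V} : RGen r x y → RGen r y z → RGen r x z

namespace Dgm

variable {n : ℕ}

/-- Vertices of the product graph: top, middle and bottom rows. -/
abbrev V3 (n : ℕ) := Fin n ⊕ (Fin n ⊕ Fin n)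

/-- The first factor occupies the top and middle rows of the product graph. -/
def topMid : PBV n → V3 n
  | Sum.inl i => Sum.inl i
  | Sum.inr i => Sum.inr (Sum.inl i)

/-- The second factor occupies the middle and bottom rows of the product graph. -/
def midBot : PBV n → V3 n
  | Sum.inl i => Sum.inr (Sum.inl i)
  | Sum.inr i => Sum.inr (Sum.inr i)

/-- The product diagram occupies the top and bottom rows of the product graph. -/
def topBot : PBV n → V3 n
  | Sum.inl i => Sum.inl i
  | Sum.inr i => Sum.inr (Sum.inr i)

/-- The edges of the product graph `Γ(α, β)`. -/
def prodEdges (α β : Dgm n) (x y : V3 n) : Prop :=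
  (∃ a b : PBV n, α.r a b ∧ x = topMid a ∧ y = topMid b) ∨
  (∃ a b : PBV n, β.r a b ∧ x = midBot a ∧ y = midBot b)

/-- The product of two diagrams: two vertices lie in the same block of `α β`
iff they are joined by a path in the product graph `Γ(α, β)`. -/
def pmul (α β : Dgm n) : Dgm n where
  r x y := RGen (prodEdges α β) (topBot x) (topBot y)
  iseqv := ⟨fun _ => RGen.refl _, fun h => h.symm, fun h₁ h₂ => h₁.trans h₂⟩

/-- Interchanging the upper and the lower vertices. -/
def swapUD : PBV n → PBV n
  | Sum.inl i => Sum.inr i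
  | Sum.inr i => Sum.inl i

/-- The involution `α ↦ α*` (reflection in a horizontal axis). -/
def pstar (α : Dgm n) : Dgm n := Setoid.comap swapUD α

/-- All blocks of `α` have size at most 2. -/
def IsPB (α : Dgm n) : Prop :=
  ∀ x y z : PBV n, α.r x y → α.r x z → x = y ∨ x = z ∨ y = z

/-- The partial Brauer monoid `PB_n` (as a set of diagrams). -/
def PBset (n : ℕ) : Set (Dgm n) := {α | IsPB α}

/-- The position of a vertex in the linear order `1 < 2 < ⋯ < n < n' < ⋯ < 1'`. -/
def vpos : PBV n → ℕ
  | Sum.inl i => (i : ℕ)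
  | Sum.inr i => 2 * n - 1 - (i : ℕ)

/-- Planarity: no two blocks cross in the order `1 < ⋯ < n < n' < ⋯ < 1'`. -/
def IsPlanar (α : Dgm n) : Prop :=
  ∀ a b c d : PBV n, α.r a b → α.r c d →
    vpos a < vpos c → vpos c < vpos b → vpos b < vpos d → False

/-- The Motzkin monoid `M_n` (as a set of diagrams). -/
def Mset (n : ℕ) : Set (Dgm n) := {α | IsPB α ∧ IsPlanar α}

/-- The domain of `α`: upper points lying in a transversal block. -/
def domSet (α : Dgm n) : Set (Fin n) := {i | ∃ j, α.r (Sum.inl i) (Sum.inr j)}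

/-- The codomain of `α`: lower points lying in a transversal block. -/
def codomSet (α : Dgm n) : Set (Fin n) := {i | ∃ j, α.r (Sum.inr i) (Sum.inl j)}

/-- The rank of a diagram: the number of its transversal blocks (for a diagram
with blocks of size at most 2, each transversal block contains exactly one
upper point, so this is the size of the domain). -/
def prank (α : Dgm n) : ℕ := (domSet α).ncard

/-- `α` is an idempotent. -/
def IsIdpt (α : Dgm n) : Prop := pmul α α = α

/-- `α` is a projection. -/
def IsProj (α : Dgm n) : Prop := pmul α α = α ∧ pstar α = α

/-- The D-class `D_r(PB_n)`. -/
def DPB (n r : ℕ) : Set (Dgm n) := {α | α ∈ PBset n ∧ prank α = r}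

/-- The ideal `I_r(PB_n)`. -/
def IPB (n r : ℕ) : Set (Dgm n) := {α | α ∈ PBset n ∧ prank α ≤ r}

/-- The D-class `D_r(M_n)`. -/
def DM (n r : ℕ) : Set (Dgm n) := {α | α ∈ Mset n ∧ prank α = r}

/-- The ideal `I_r(M_n)`. -/
def IM (n r : ℕ) : Set (Dgm n) := {α | α ∈ Mset n ∧ prank α ≤ r}

end Dgm

/-- Membership in the closure of a subset under a binary operation. -/
inductive MClo {γ : Type*} (m : γ → γ → γ) (X : Set γ) : γ → Prop
  | base {x : γ} : x ∈ X → MClo m X x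
  | mul {x y : γ} : MClo m X x → MClo m X y → MClo m X (m x y)

/-- The subsemigroup `⟨X⟩` generated by the subset `X`. -/
def genSet {γ : Type*} (m : γ → γ → γ) (X : Set γ) : Set γ := {x | MClo m X x}

/-- The rank of `T`: the least size of a generating set. -/
noncomputable def rnk {γ : Type*} (m : γ → γ → γ) (T : Set γ) : ℕ :=
  sInf {k | ∃ X : Finset γ, X.card = k ∧ genSet m ↑X = T}

/-- The idempotent rank of `T`: the least size of a generating set consisting
of idempotents. -/
noncomputable def idrnk {γ : Type*} (m : γ → γ → γ) (T : Set γ) : ℕ :=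
  sInf {k | ∃ X : Finset γ, X.card = k ∧ (∀ x ∈ X, m x x = x) ∧ genSet m ↑X = T}

/-- `T` is idempotent-generated. -/
def IdptGen {γ : Type*} (m : γ → γ → γ) (T : Set γ) : Prop :=
  genSet m {x ∈ T | m x x = x} = T

open Dgm
/-- `a(m)`: `a(0) = a(1) = 1` and `a(m) = a(m-1) + (m-1)·a(m-2)`. -/
def aSeq : ℕ → ℕ
  | 0 => 1
  | 1 => 1
  | (m + 2) => aSeq (m + 1) + (m + 1) * aSeq m

/-- The double factorial `k!!`, with the convention `k!! = 0` for even `k ≥ 0`. -/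
def oddDF : ℕ → ℕ
  | 0 => 0
  | 1 => 1
  | (k + 2) => (k + 2) * oddDF k

namespace Dgm

variable {n : ℕ}

/-- `{x}` is a singleton upper block of `α`. -/
def UpperSingleton (α : Dgm n) (x : Fin n) : Prop :=
  ∀ y : PBV n, α.r (Sum.inl x) y → y = Sum.inl x

/-- `{x'}` is a singleton lower block of `α`. -/
def LowerSingleton (α : Dgm n) (x : Fin n) : Prop :=
  ∀ y : PBV n, α.r (Sum.inr x) y → y = Sum.inr x

/-- The upper point `x` is nested: some upper block `{u,v}` has `u < x < v`. -/
def UpperNested (α : Dgm n) (x : Fin n) : Prop :=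
  ∃ u v : Fin n, α.r (Sum.inl u) (Sum.inl v) ∧ u < x ∧ x < v

/-- The lower point `x'` is nested: some lower block `{u',v'}` has `u < x < v`. -/
def LowerNested (α : Dgm n) (x : Fin n) : Prop :=
  ∃ u v : Fin n, α.r (Sum.inr u) (Sum.inr v) ∧ u < x ∧ x < v

/-- `α` has no unnested singleton (upper or lower) block. -/
def NoUnnestedSingleton (α : Dgm n) : Prop :=
  (∀ x, UpperSingleton α x → UpperNested α x) ∧
  (∀ x, LowerSingleton α x → LowerNested α x)

/-- A chain of `d` nested upper hooks of `α` around the upper point `x`: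
`u_{d-1} < ⋯ < u_0 < x < v_0 < ⋯ < v_{d-1}` with each `{u_i, v_i}` a block.
The singleton upper block `{x}` has nesting depth at most `k` iff there is no
such chain of length `k + 1`. -/
def UpperHookChain (α : Dgm n) (x : Fin n) (d : ℕ) : Prop :=
  ∃ u v : Fin d → Fin n,
    (∀ i, α.r (Sum.inl (u i)) (Sum.inl (v i))) ∧
    (∀ i, u i < x ∧ x < v i) ∧ StrictAnti u ∧ StrictMono v

/-- A chain of `d` nested lower hooks of `α` around the lower point `x'`. -/
def LowerHookChain (α : Dgm n) (x : Fin n) (d : ℕ) : Prop :=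
  ∃ u v : Fin d → Fin n,
    (∀ i, α.r (Sum.inr (u i)) (Sum.inr (v i))) ∧
    (∀ i, u i < x ∧ x < v i) ∧ StrictAnti u ∧ StrictMono v

/-- `λ_A`: the planar diagram joining the `k`-th smallest element of `A`
(upper) to `k` (lower), all other blocks being singletons. -/
def lamd (A : Finset (Fin n)) : Dgm n :=
  Setoid.ker (fun x : PBV n =>
    match x with
    | Sum.inl a =>
        if ha : a ∈ A then
          (Sum.inr (((A.orderIsoOfFin rfl).symm ⟨a, ha⟩ : Fin A.card) : ℕ) : ℕ ⊕ ℕ)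
        else Sum.inl (a : ℕ)
    | Sum.inr j => Sum.inr (j : ℕ))

/-- `ρ_A = (λ_A)*`. -/
def rhod (A : Finset (Fin n)) : Dgm n := pstar (lamd A)

/-- The diagram whose 2-element blocks are exactly `{i, (π i)'}` for `i < r`. -/
def permDgm (n r : ℕ) (π : Equiv.Perm (Fin r)) : Dgm n :=
  Setoid.ker (fun x : PBV n =>
    match x with
    | Sum.inl a =>
        if h : (a : ℕ) < r then (Sum.inr ((π ⟨(a : ℕ), h⟩ : Fin r) : ℕ) : ℕ ⊕ ℕ)
        else Sum.inl (a : ℕ)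
    | Sum.inr j => Sum.inr (j : ℕ))

/-- The set `S_{[r]} ⊆ PB_n`. -/
def SBr (n r : ℕ) : Set (Dgm n) := {γ | ∃ π : Equiv.Perm (Fin r), γ = permDgm n r π}

/-- The domain of `α` as a `Finset`. -/
def domFinset (α : Dgm n) : Finset (Fin n) :=
  Finset.univ.filter fun i => i ∈ domSet α

/-- The codomain of `α` as a `Finset`. -/
def codomFinset (α : Dgm n) : Finset (Fin n) :=
  Finset.univ.filter fun i => i ∈ codomSet α

/-- `A ⊆ {1,…,n}` is cosparse: its complement contains no two consecutive
elements. -/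
def CosparseS (A : Set (Fin n)) : Prop :=
  ∀ i j : Fin n, i ∉ A → j ∉ A → (j : ℕ) ≠ (i : ℕ) + 1

/-- `id_A`: the diagram with blocks `{a, a'}` for `a ∈ A`, all other blocks
being singletons. -/
def idd (A : Set (Fin n)) : Dgm n :=
  Setoid.ker (fun x : PBV n =>
    match x with
    | Sum.inl a => if a ∈ A then (Sum.inr (a : ℕ) : ℕ ⊕ ℕ) else Sum.inl (a : ℕ)
    | Sum.inr j => Sum.inr (j : ℕ))

end Dgm

namespace Dgm

variable {n : ℕ}

/-- orbit membership -/
def Orb {V : Type*} (F : Bool → V → V) (a v : V) : Prop :=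
  ∀ P : V → Prop, P a → (∀ s z, P z → P (F s z)) → P v

def walk {V : Type*} (F : Bool → V → V) (s0 : Bool) (a : V) : ℕ → V
  | 0 => a
  | k + 1 => F (xor s0 (decide (k % 2 = 0))) (walk F s0 a k)

theorem flag_unique {V : Type*} (F : Bool → V → V) (hF : ∀ s z, F s (F s z) = z)
    (s0 : Bool) (a : V) (ha : F s0 a = a) (s t : Bool) (v z : V)
    (hv : Orb F a v) (hz : Orb F a z) (hsv : F s v = v) (htz : F t z = z)
    (h1 : ¬ (s = s0 ∧ v = a)) (h2 : ¬ (t = s0 ∧ z = a)) : s = t ∧ v = z := by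
  set w := walk F s0 a with hw
  set g : ℕ → Bool := fun k => xor s0 (decide (k % 2 = 0)) with hg
  have w0 : w 0 = a := rfl
  have wS : ∀ k, w (k + 1) = F (g k) (w k) := fun k => rfl
  have gg : ∀ k, g (k + 2) = g k := by
    intro k; simp only [hg]; congr 2; simp
  have gcase : ∀ k s, s = g k ∨ s = g (k + 1) := by
    intro k s
    simp only [hg]
    rcases Nat.mod_two_eq_zero_or_one k with h | h
    · have : (k + 1) % 2 = 1 := by omega
      simp only [h, this]; cases s <;> cases s0 <;> simp
    · have : (k + 1) % 2 = 0 := by omega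
      simp only [h, this]; cases s <;> cases s0 <;> simp
  have g1 : g 1 = s0 := by simp [hg]
  have wP : ∀ k, F (g (k + 2)) (w (k + 1)) = w k := by
    intro k; rw [gg, wS, hF]
  have wP0 : F (g 1) (w 0) = w 0 := by rw [g1, w0, ha]
  -- a flag gives a repetition
  have key : ∀ s k, F s (w k) = w k → ¬ (s = s0 ∧ w k = a) →
      (s = g k ∧ w (k + 1) = w k) ∨ (∃ j, k = j + 1 ∧ w (j + 1) = w j) := by
    intro s k h hne
    rcases gcase k s with e | e
    · left; refine ⟨e, ?_⟩; rw [wS, ← e, h]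
    · right
      cases k with
      | zero => exact absurd ⟨e.trans g1, w0⟩ hne
      | succ j => refine ⟨j, rfl, ?_⟩; rw [e] at h; rw [← h]; exact wP j
  by_cases hK : ∃ K, w (K + 1) = w K
  · classical
    obtain ⟨K, hK1, hK2⟩ : ∃ K, w (K + 1) = w K ∧ ∀ j < K, w (j + 1) ≠ w j :=
      ⟨Nat.find hK, Nat.find_spec hK, fun j hj => Nat.find_min hK hj⟩
    have orb : ∀ v, Orb F a v → ∃ k ≤ K, v = w k := by
      intro v hv
      refine hv (fun v => ∃ k ≤ K, v = w k) ⟨0, Nat.zero_le _, rfl⟩ ?_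
      rintro s _ ⟨k, hk, rfl⟩
      rcases gcase k s with rfl | rfl
      · rcases hk.lt_or_eq with h | rfl
        · exact ⟨k + 1, h, rfl⟩
        · exact ⟨k, le_rfl, by rw [← wS, hK1]⟩
      · cases k with
        | zero => exact ⟨0, hk, wP0⟩
        | succ j => exact ⟨j, by omega, wP j⟩
    have fin : ∀ s v, Orb F a v → F s v = v → ¬ (s = s0 ∧ v = a) → s = g K ∧ v = w K := by
      intro s v hv hs hne
      obtain ⟨k, hk, rfl⟩ := orb v hv
      rcases key s k hs hne with ⟨e, h⟩ | ⟨j, rfl, h⟩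
      · rcases hk.lt_or_eq with h' | rfl
        · exact absurd h (hK2 k h')
        · exact ⟨e, rfl⟩
      · exact absurd h (hK2 j (by omega))
    obtain ⟨e1, e2⟩ := fin s v hv hsv h1
    obtain ⟨e3, e4⟩ := fin t z hz htz h2
    exact ⟨e1.trans e3.symm, e2.trans e4.symm⟩
  · exfalso
    have orb : ∃ k, v = w k := by
      refine hv (fun v => ∃ k, v = w k) ⟨0, rfl⟩ ?_
      rintro s _ ⟨k, rfl⟩
      rcases gcase k s with rfl | rfl
      · exact ⟨k + 1, rfl⟩
      · cases k with
        | zero => exact ⟨0, wP0⟩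
        | succ j => exact ⟨j, wP j⟩
    obtain ⟨k, rfl⟩ := orb
    rcases key s k hsv h1 with ⟨e, h⟩ | ⟨j, rfl, h⟩
    · exact hK ⟨k, h⟩
    · exact hK ⟨j, h⟩

/-- partner of a vertex -/
def ptn (α : Dgm n) (x : PBV n) : PBV n :=
  if h : ∃ y, y ≠ x ∧ α.r x y then h.choose else x

theorem ptn_rel (α : Dgm n) (x : PBV n) : α.r x (ptn α x) := by
  unfold ptn
  split_ifs with h
  · exact h.choose_spec.2
  · exact α.iseqv.refl x

theorem rel_iff {α : Dgm n} (hα : IsPB α) (x y : PBV n) : α.r x y ↔ y = x ∨ y = ptn α x := by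
  constructor
  · intro h
    by_cases e : y = x
    · exact Or.inl e
    · right
      have hex : ∃ y, y ≠ x ∧ α.r x y := ⟨y, e, h⟩
      have h1 : ptn α x ≠ x := by
        unfold ptn; rw [dif_pos hex]; exact hex.choose_spec.1
      rcases hα x y (ptn α x) h (ptn_rel α x) with h' | h' | h'
      · exact absurd h'.symm e
      · exact absurd h'.symm h1
      · exact h'
  · rintro (rfl | rfl)
    · exact α.iseqv.refl _
    · exact ptn_rel α x

theorem ptn_ptn {α : Dgm n} (hα : IsPB α) (x : PBV n) : ptn α (ptn α x) = x := by
  have h := α.iseqv.symm (ptn_rel α x)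
  rcases (rel_iff hα _ _).1 h with h | h
  · rw [← h, ← h]
  · exact h.symm

/-- the two involutions on the product graph -/
def FF (α β : Dgm n) : Bool → V3 n → V3 n
  | true, Sum.inl i => topMid (ptn α (Sum.inl i))
  | true, Sum.inr (Sum.inl i) => topMid (ptn α (Sum.inr i))
  | true, Sum.inr (Sum.inr i) => Sum.inr (Sum.inr i)
  | false, Sum.inl i => Sum.inl i
  | false, Sum.inr (Sum.inl i) => midBot (ptn β (Sum.inl i))
  | false, Sum.inr (Sum.inr i) => midBot (ptn β (Sum.inr i))

theorem FF_top (α β : Dgm n) (x : PBV n) : FF α β true (topMid x) = topMid (ptn α x) := by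
  rcases x with i | i <;> rfl

theorem FF_bot (α β : Dgm n) (x : PBV n) : FF α β false (midBot x) = midBot (ptn β x) := by
  rcases x with i | i <;> rfl

theorem FF_inv {α β : Dgm n} (hα : IsPB α) (hβ : IsPB β) (s : Bool) (z : V3 n) :
    FF α β s (FF α β s z) = z := by
  cases s
  · rcases z with i | i | i
    · rfl
    · change FF α β false (FF α β false (midBot (Sum.inl i))) = midBot (Sum.inl i)
      rw [FF_bot, FF_bot, ptn_ptn hβ]
    · change FF α β false (FF α β false (midBot (Sum.inr i))) = midBot (Sum.inr i)
      rw [FF_bot, FF_bot, ptn_ptn hβ]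
  · rcases z with i | i | i
    · change FF α β true (FF α β true (topMid (Sum.inl i))) = topMid (Sum.inl i)
      rw [FF_top, FF_top, ptn_ptn hα]
    · change FF α β true (FF α β true (topMid (Sum.inr i))) = topMid (Sum.inr i)
      rw [FF_top, FF_top, ptn_ptn hα]
    · rfl

theorem orb_of_rgen {α β : Dgm n} (hα : IsPB α) (hβ : IsPB β) {x y : V3 n}
    (h : RGen (prodEdges α β) x y) : Orb (FF α β) x y := by
  intro P hx hP
  have aux : ∀ x y, RGen (prodEdges α β) x y → (P x ↔ P y) := by
    intro x y h
    induction h with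
    | rel h =>
      have e1 : ∀ a b, α.r a b → P (topMid a) → P (topMid b) := by
        intro a b h hp
        rcases (rel_iff hα _ _).1 h with rfl | rfl
        · exact hp
        · rw [← FF_top α β]; exact hP _ _ hp
      have e2 : ∀ a b, β.r a b → P (midBot a) → P (midBot b) := by
        intro a b h hp
        rcases (rel_iff hβ _ _).1 h with rfl | rfl
        · exact hp
        · rw [← FF_bot α β]; exact hP _ _ hp
      rcases h with ⟨a, b, h, rfl, rfl⟩ | ⟨a, b, h, rfl, rfl⟩
      · exact ⟨e1 _ _ h, e1 _ _ (α.iseqv.symm h)⟩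
      · exact ⟨e2 _ _ h, e2 _ _ (β.iseqv.symm h)⟩
    | refl x => exact Iff.rfl
    | symm _ ih => exact ih.symm
    | trans _ _ i1 i2 => exact i1.trans i2
  exact (aux x y h).1 hx

theorem topBot_inj {x y : PBV n} (h : topBot x = topBot y) : x = y := by
  rcases x with i | i <;> rcases y with j | j <;> simp_all [topBot]

def oflag : PBV n → Bool
  | Sum.inl _ => false
  | Sum.inr _ => true

theorem oflag_fix (α β : Dgm n) (x : PBV n) : FF α β (oflag x) (topBot x) = topBot x := by
  rcases x with i | i <;> rfl

theorem pmul_flag {α β : Dgm n} (hα : IsPB α) (hβ : IsPB β) {x y : PBV n} (hxy : x ≠ y)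
    (h : (pmul α β).r x y) {s : Bool} {v : V3 n} (hv : RGen (prodEdges α β) (topBot x) v)
    (hs : FF α β s v = v) : (s = oflag x ∧ v = topBot x) ∨ (s = oflag y ∧ v = topBot y) := by
  by_cases hc : s = oflag x ∧ v = topBot x
  · exact Or.inl hc
  · right
    exact flag_unique (FF α β) (FF_inv hα hβ) (oflag x) (topBot x) (oflag_fix α β x) s (oflag y)
      v (topBot y) (orb_of_rgen hα hβ hv) (orb_of_rgen hα hβ h) hs (oflag_fix α β y) hc
      (fun h' => hxy (topBot_inj h'.2).symm)

theorem pmul_isPB {α β : Dgm n} (hα : IsPB α) (hβ : IsPB β) : IsPB (pmul α β) := by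
  intro x y z hxy hxz
  by_cases e : x = y
  · exact Or.inl e
  · rcases pmul_flag hα hβ e hxy hxz (oflag_fix α β z) with h | h
    · exact Or.inr (Or.inl (topBot_inj h.2).symm)
    · exact Or.inr (Or.inr (topBot_inj h.2).symm)

theorem vpos_inj {x y : PBV n} (h : vpos x = vpos y) : x = y := by
  rcases x with i | i <;> rcases y with j | j <;> simp only [vpos] at h
  · congr 1; ext; exact h
  · have := i.2; have := j.2; omega
  · have := i.2; have := j.2; omega
  · have := i.2; have := j.2; congr 1; ext; omega

/-- parity of the number of elements of `S` before `x`. -/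
def cnt (S : PBV n → Prop) (x : PBV n) : ZMod 2 :=
  ∑ u, if S u ∧ vpos u < vpos x then 1 else 0

theorem cnt_eq {α : Dgm n} (hα : IsPB α) (hp : IsPlanar α) (S : PBV n → Prop)
    (hS : ∀ u, S u → S (ptn α u)) (hf : ∀ u, S u → ptn α u ≠ u) {x y : PBV n}
    (hx : ¬ S x) (hxy : α.r x y) : cnt S x = cnt S y := by
  have h2 : ∀ a b : ZMod 2, a + b = 0 → a = b := by decide
  have hS' : ∀ u, S u ↔ S (ptn α u) := fun u => ⟨hS u, fun h => by
    have := hS _ h; rwa [ptn_ptn hα] at this⟩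
  by_cases exy : x = y
  · rw [exy]
  have hy : ¬ S y := by
    rcases (rel_iff hα _ _).1 hxy with rfl | rfl
    · exact hx
    · rwa [← hS']
  apply h2
  unfold cnt
  rw [← Finset.sum_add_distrib]
  -- noncrossing
  have nc : ∀ u, S u → ((vpos u < vpos x ↔ vpos u < vpos y) ↔
      (vpos (ptn α u) < vpos x ↔ vpos (ptn α u) < vpos y)) := by
    have aux : ∀ x y, α.r x y → ¬ S x → ¬ S y → vpos x < vpos y → ∀ u, S u →
        vpos x < vpos u → vpos u < vpos y →
        vpos x < vpos (ptn α u) ∧ vpos (ptn α u) < vpos y := by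
      intro x y hxy hx hy hlt u hu h3 h4
      have r1 := ptn_rel α u
      have r2 := α.iseqv.symm r1
      have n1 : vpos (ptn α u) ≠ vpos x := fun h => hx (vpos_inj h ▸ hS u hu)
      have n2 : vpos (ptn α u) ≠ vpos y := fun h => hy (vpos_inj h ▸ hS u hu)
      constructor
      · by_contra hc
        exact hp _ _ _ _ r2 hxy (by omega) h3 h4
      · by_contra hc
        exact hp _ _ _ _ hxy r1 h3 h4 (by omega)
    have aux2 : ∀ x y, α.r x y → ¬ S x → ¬ S y → vpos x < vpos y → ∀ u, S u →
        ((vpos u < vpos x ↔ vpos u < vpos y) ↔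
      (vpos (ptn α u) < vpos x ↔ vpos (ptn α u) < vpos y)) := by
      intro x y hxy hx hy hlt u hu
      have a1 := aux x y hxy hx hy hlt u hu
      have a2 := aux x y hxy hx hy hlt _ (hS u hu)
      rw [ptn_ptn hα] at a2
      have n1 : vpos (ptn α u) ≠ vpos x := fun h => hx (vpos_inj h ▸ hS u hu)
      have n2 : vpos (ptn α u) ≠ vpos y := fun h => hy (vpos_inj h ▸ hS u hu)
      have n3 : vpos u ≠ vpos x := fun h => hx (vpos_inj h ▸ hu)
      have n4 : vpos u ≠ vpos y := fun h => hy (vpos_inj h ▸ hu)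
      constructor
      · intro h; by_contra hc
        have := a2 (by omega) (by omega)
        omega
      · intro h; by_contra hc
        have := a1 (by omega) (by omega)
        omega
    intro u hu
    rcases lt_trichotomy (vpos x) (vpos y) with h | h | h
    · exact aux2 x y hxy hx hy h u hu
    · exact absurd (vpos_inj h) exy
    · have := aux2 y x (α.iseqv.symm hxy) hy hx h u hu
      tauto
  apply Finset.sum_involution (fun u _ => ptn α u)
  · intro u _
    by_cases hu : S u
    · have hu' := hS u hu
      have := nc u hu
      simp only [hu, hu', true_and]
      by_cases b1 : vpos u < vpos x <;> by_cases b2 : vpos u < vpos y <;>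
      by_cases b3 : vpos (ptn α u) < vpos x <;> by_cases b4 : vpos (ptn α u) < vpos y <;>
      simp only [b1, b2, b3, b4] at this ⊢ <;> first | (simp at this; done) | decide
    · have hu' : ¬ S (ptn α u) := fun h => hu ((hS' u).2 h)
      simp [hu, hu']
  · intro u _ hne
    by_cases hu : S u
    · exact hf u hu
    · simp [hu] at hne
  · intro u _; exact Finset.mem_univ _
  · intro u _; exact ptn_ptn hα u

theorem pmul_planar {α β : Dgm n} (hα : IsPB α) (hβ : IsPB β) (pα : IsPlanar α)
    (pβ : IsPlanar β) : IsPlanar (pmul α β) := by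
  intro a b c d hab hcd h1 h2 h3
  have nab : a ≠ b := by rintro rfl; omega
  have nac : a ≠ c := by rintro rfl; omega
  have nbc : b ≠ c := by rintro rfl; omega
  set S : V3 n → Prop := fun v => RGen (prodEdges α β) (topBot a) v with hSdef
  have Srel : ∀ x y, RGen (prodEdges α β) x y → (S x ↔ S y) := fun x y h =>
    ⟨fun h' => h'.trans h, fun h' => h'.trans h.symm⟩
  have hSα : ∀ u, S (topMid u) → S (topMid (ptn α u)) := fun u h =>
    (Srel _ _ (RGen.rel (Or.inl ⟨u, _, ptn_rel α u, rfl, rfl⟩))).1 h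
  have hSβ : ∀ u, S (midBot u) → S (midBot (ptn β u)) := fun u h =>
    (Srel _ _ (RGen.rel (Or.inr ⟨u, _, ptn_rel β u, rfl, rfl⟩))).1 h
  have nfα : ∀ u, S (topMid u) → ptn α u ≠ u := by
    intro u hu he
    have : FF α β true (topMid u) = topMid u := by rw [FF_top, he]
    rcases pmul_flag hα hβ nab hab hu this with ⟨e1, e2⟩ | ⟨e1, e2⟩
    · rcases a with i | i <;> rcases u with j | j <;> simp [oflag, topBot, topMid] at e1 e2
    · rcases b with i | i <;> rcases u with j | j <;> simp [oflag, topBot, topMid] at e1 e2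
  have nfβ : ∀ u, S (midBot u) → ptn β u ≠ u := by
    intro u hu he
    have : FF α β false (midBot u) = midBot u := by rw [FF_bot, he]
    rcases pmul_flag hα hβ nab hab hu this with ⟨e1, e2⟩ | ⟨e1, e2⟩
    · rcases a with i | i <;> rcases u with j | j <;> simp [oflag, topBot, midBot] at e1 e2
    · rcases b with i | i <;> rcases u with j | j <;> simp [oflag, topBot, midBot] at e1 e2
  have Sout : ∀ u, S (topBot u) ↔ u = a ∨ u = b := by
    intro u
    constructor
    · intro h
      rcases pmul_isPB hα hβ a b u hab h with h | h | h
      · exact absurd h nab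
      · exact Or.inl h.symm
      · exact Or.inr h.symm
    · rintro (rfl | rfl)
      · exact RGen.refl _
      · exact hab
  have hcS : ¬ S (topBot c) := by
    rw [Sout]; rintro (h | h)
    · exact nac h.symm
    · exact nbc h.symm
  set cα := cnt (fun u => S (topMid u)) with hcα
  set cβ := cnt (fun u => S (midBot u)) with hcβ
  set C : ZMod 2 := (∑ i : Fin n, if S (Sum.inl i) then 1 else 0) +
    ∑ i : Fin n, if S (Sum.inr (Sum.inl i)) then 1 else 0 with hC
  set f : V3 n → ZMod 2 := fun v => match v with
    | Sum.inl i => cα (Sum.inl i)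
    | Sum.inr (Sum.inl i) => cα (Sum.inr i)
    | Sum.inr (Sum.inr i) => cβ (Sum.inr i) + C with hf
  have two : ∀ z : ZMod 2, z + z = 0 := by decide
  have hmid : ∀ m, ¬ S (Sum.inr (Sum.inl m)) → cα (Sum.inr m) = cβ (Sum.inl m) + C := by
    intro m hm
    have : cα (Sum.inr m) + cβ (Sum.inl m) = C := by
      simp only [hcα, hcβ, cnt, hC, Fintype.sum_sum_type, topMid, midBot, vpos]
      rw [add_assoc]
      congr 1
      · apply Finset.sum_congr rfl
        intro i _
        have : (i : ℕ) < 2 * n - 1 - m := by omega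
        simp [this]
      · rw [← Finset.sum_add_distrib, ← Finset.sum_add_distrib]
        apply Finset.sum_congr rfl
        intro i _
        have e1 : ¬ (2 * n - 1 - (i : ℕ) < m) := by omega
        by_cases hi : S (Sum.inr (Sum.inl i))
        · have ne : (i : ℕ) ≠ m := by
            intro h; apply hm; rw [← Fin.ext h]; exact hi
          rcases lt_or_gt_of_ne ne with h | h
          · have e2 : ¬ (2 * n - 1 - (i : ℕ) < 2 * n - 1 - m) := by omega
            simp [hi, e1, e2, h]
          · have e2 : (2 * n - 1 - (i : ℕ) < 2 * n - 1 - m) := by omega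
            have e3 : ¬ (i : ℕ) < m := by omega
            simp [hi, e1, e2, e3]
        · simp [hi, e1]
    rw [← this]
    have := two (cβ (Sum.inl m))
    linear_combination -this
  have hfα : ∀ u, f (topMid u) = cα u := by rintro (i | i) <;> rfl
  have hfβ : ∀ u, ¬ S (midBot u) → f (midBot u) = cβ u + C := by
    rintro (i | i) h
    · exact hmid i h
    · rfl
  have hconst : ∀ x y, RGen (prodEdges α β) x y → ¬ S x → f x = f y := by
    intro x y h
    induction h with
    | rel h =>
      rcases h with ⟨u, v, h, rfl, rfl⟩ | ⟨u, v, h, rfl, rfl⟩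
      · intro hx
        rw [hfα, hfα]
        exact cnt_eq hα pα _ hSα nfα hx h
      · intro hx
        have hy : ¬ S (midBot v) := by
          rwa [← Srel _ _ (RGen.rel (Or.inr ⟨u, v, h, rfl, rfl⟩))]
        rw [hfβ _ hx, hfβ _ hy]
        congr 1
        exact cnt_eq hβ pβ _ hSβ nfβ hx h
    | refl x => intro _; rfl
    | symm h ih => intro hx; exact (ih (by rwa [Srel _ _ h])).symm
    | trans h h' i1 i2 => intro hx; exact (i1 hx).trans (i2 (by rwa [← Srel _ _ h]))
  have hout : ∀ u, f (topBot u) = (if vpos a < vpos u then 1 else 0) +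
      (if vpos b < vpos u then 1 else 0) := by
    intro u
    have e1 : f (topBot u) = ∑ z, if S (topBot z) ∧ vpos z < vpos u then 1 else 0 := by
      rcases u with j | j
      · simp only [hf, topBot, hcα, cnt, Fintype.sum_sum_type, topMid, vpos]
        congr 1
        apply Finset.sum_congr rfl
        intro i _
        have : ¬ (2 * n - 1 - (i : ℕ) < j) := by omega
        simp [this]
      · simp only [hf, topBot, hcβ, hC, cnt, Fintype.sum_sum_type, midBot, vpos]
        have q1 : ∀ (i : Fin n), (i : ℕ) < 2 * n - 1 - j := fun i => by omega
        simp only [q1, and_true]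
        have key : ∀ A B D D' : ZMod 2, B + B = 0 → D = D' → B + D + (A + B) = A + D' := by
          decide
        refine key _ _ _ _ (two _) ?_
        apply Finset.sum_congr rfl
        intro i _
        congr
    rw [e1]
    have : ∀ z, (if S (topBot z) ∧ vpos z < vpos u then (1 : ZMod 2) else 0) =
        (if z = a then (if vpos a < vpos u then 1 else 0) else 0) +
        (if z = b then (if vpos b < vpos u then 1 else 0) else 0) := by
      intro z
      rw [Sout]
      by_cases ha : z = a
      · subst ha; simp [nab]
      · by_cases hb : z = b
        · subst hb; simp [ha]
        · simp [ha, hb]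
    simp only [this, Finset.sum_add_distrib, Finset.sum_ite_eq', Finset.mem_univ, if_true]
  have := hconst _ _ hcd hcS
  rw [hout, hout] at this
  have c1 : ¬ vpos b < vpos c := by omega
  have c2 : vpos a < vpos d := by omega
  simp only [h1, c1, c2, h3, if_true, if_false] at this
  revert this; decide

theorem pmul_dom {α β : Dgm n} : domSet (pmul α β) ⊆ domSet α := by
  rintro i ⟨j, h⟩
  by_contra hc
  have aux : ∀ x y, RGen (prodEdges α β) x y →
      ((∃ i', α.r (Sum.inl i) (Sum.inl i') ∧ x = Sum.inl i') ↔
       (∃ i', α.r (Sum.inl i) (Sum.inl i') ∧ y = Sum.inl i')) := by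
    have e1 : ∀ a b, α.r a b → (∃ i', α.r (Sum.inl i) (Sum.inl i') ∧ topMid a = Sum.inl i') →
        (∃ i', α.r (Sum.inl i) (Sum.inl i') ∧ topMid b = Sum.inl i') := by
      rintro (a | a) (b | b) h ⟨i', h1, h2⟩ <;> simp [topMid] at h2
      · subst h2; exact ⟨b, α.iseqv.trans h1 h, rfl⟩
      · subst h2; exact absurd ⟨b, α.iseqv.trans h1 h⟩ hc
    intro x y h
    induction h with
    | rel h =>
      rcases h with ⟨u, v, h, rfl, rfl⟩ | ⟨u, v, h, rfl, rfl⟩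
      · exact ⟨e1 _ _ h, e1 _ _ (α.iseqv.symm h)⟩
      · rcases u with u | u <;> rcases v with v | v <;> simp [midBot]
    | refl x => exact Iff.rfl
    | symm _ ih => exact ih.symm
    | trans _ _ i1 i2 => exact i1.trans i2
  obtain ⟨i', _, h'⟩ := (aux _ _ h).1 ⟨i, α.iseqv.refl _, rfl⟩
  simp [topBot] at h'

theorem pmul_IM {r : ℕ} {α β : Dgm n} (hα : α ∈ IM n r) (hβ : β ∈ IM n r) :
    pmul α β ∈ IM n r :=
  ⟨⟨pmul_isPB hα.1.1 hβ.1.1, pmul_planar hα.1.1 hβ.1.1 hα.1.2 hβ.1.2⟩,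
    (Set.ncard_le_ncard pmul_dom (Set.toFinite _)).trans hα.2⟩

structure Good (U T L : Fin n → Fin n → Prop) : Prop where
  ur : ∀ i, U i i
  us : ∀ i j, U i j → U j i
  um : ∀ i j k, U i j → U i k → i = j ∨ i = k ∨ j = k
  lr : ∀ i, L i i
  ls : ∀ i j, L i j → L j i
  lm : ∀ i j k, L i j → L i k → i = j ∨ i = k ∨ j = k
  tu : ∀ i j k, T i j → U i k → k = i
  tl : ∀ i j k, T i j → L j k → k = j
  tt : ∀ i j k, T i j → T i k → j = k
  pu : ∀ a b c d, U a b → U c d → a < c → c < b → b < d → False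
  pl : ∀ a b c d, L a b → L c d → a < c → c < b → b < d → False
  put : ∀ a b c d, U a b → T c d → a < c → c < b → False
  plt : ∀ a b c d, L a b → T d c → a < c → c < b → False
  pt : ∀ a b c d, T a b → T c d → a < c → b < d

theorem Good.tt' {U T L : Fin n → Fin n → Prop} (h : Good U T L) (i j k : Fin n)
    (h1 : T i k) (h2 : T j k) : i = j := by
  rcases lt_trichotomy i j with e | e | e
  · exact absurd (h.pt _ _ _ _ h1 h2 e) (lt_irrefl _)
  · exact e
  · exact absurd (h.pt _ _ _ _ h2 h1 e) (lt_irrefl _)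

def mrel (U T L : Fin n → Fin n → Prop) : PBV n → PBV n → Prop
  | Sum.inl i, Sum.inl j => U i j
  | Sum.inl i, Sum.inr j => T i j
  | Sum.inr i, Sum.inl j => T j i
  | Sum.inr i, Sum.inr j => L i j

theorem mrel_m {U T L : Fin n → Fin n → Prop} (h : Good U T L) (x y z : PBV n)
    (h1 : mrel U T L x y) (h2 : mrel U T L x z) : x = y ∨ x = z ∨ y = z := by
  rcases x with x | x <;> rcases y with y | y <;> rcases z with z | z <;>
    simp only [mrel, Sum.inl.injEq, Sum.inr.injEq, reduceCtorEq, false_or, or_false] at h1 h2 ⊢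
  · exact h.um _ _ _ h1 h2
  · exact (h.tu _ _ _ h2 h1).symm
  · exact (h.tu _ _ _ h1 h2).symm
  · exact h.tt _ _ _ h1 h2
  · exact h.tt' _ _ _ h1 h2
  · exact (h.tl _ _ _ h1 h2).symm
  · exact (h.tl _ _ _ h2 h1).symm
  · exact h.lm _ _ _ h1 h2

theorem mrel_s {U T L : Fin n → Fin n → Prop} (h : Good U T L) (x y : PBV n)
    (h1 : mrel U T L x y) : mrel U T L y x := by
  rcases x with x | x <;> rcases y with y | y <;> simp only [mrel] at h1 ⊢
  · exact h.us _ _ h1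
  · exact h1
  · exact h1
  · exact h.ls _ _ h1

def mkD (U T L : Fin n → Fin n → Prop) (h : Good U T L) : Dgm n where
  r := mrel U T L
  iseqv := by
    have hr : ∀ x, mrel U T L x x := by
      rintro (x | x)
      · exact h.ur x
      · exact h.lr x
    refine ⟨hr, fun {x y} h1 => mrel_s h x y h1, fun {x y z} h1 h2 => ?_⟩
    rcases mrel_m h y x z (mrel_s h _ _ h1) h2 with rfl | rfl | rfl
    · exact h2
    · exact h1
    · exact hr _

theorem mkD_mem {U T L : Fin n → Fin n → Prop} (h : Good U T L) : mkD U T L h ∈ Mset n := by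
  refine ⟨mrel_m h, ?_⟩
  intro a b c d h1 h2 h3 h4 h5
  change mrel U T L a b at h1
  change mrel U T L c d at h2
  rcases a with a | a <;> rcases b with b | b <;> rcases c with c | c <;> rcases d with d | d <;>
    simp only [mrel, vpos] at h1 h2 h3 h4 h5 <;> try omega
  · exact h.pu _ _ _ _ h1 h2 h3 h4 h5
  · exact h.put _ _ _ _ h1 h2 h3 h4
  · have := h.pt _ _ _ _ h1 h2 h3
    have : (b : ℕ) < d := this
    omega
  · exact h.plt d c b a (h.ls _ _ h2) h1 (by rw [Fin.lt_def]; omega) (by rw [Fin.lt_def]; omega)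
  · exact h.pl d c b a (h.ls _ _ h2) (h.ls _ _ h1) (by rw [Fin.lt_def]; omega)
      (by rw [Fin.lt_def]; omega) (by rw [Fin.lt_def]; omega)

theorem good_of {α : Dgm n} (h : α ∈ Mset n) :
    Good (fun i j => α.r (Sum.inl i) (Sum.inl j)) (fun i j => α.r (Sum.inl i) (Sum.inr j))
      (fun i j => α.r (Sum.inr i) (Sum.inr j)) := by
  obtain ⟨h1, h2⟩ := h
  refine ⟨fun i => α.iseqv.refl _, fun i j => α.iseqv.symm, ?_, fun i => α.iseqv.refl _,
    fun i j => α.iseqv.symm, ?_, ?_, ?_, ?_, ?_, ?_, ?_, ?_, ?_⟩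
  · intro i j k a b; simpa using h1 _ _ _ a b
  · intro i j k a b; simpa using h1 _ _ _ a b
  · intro i j k a b; simpa [eq_comm] using h1 _ _ _ a b
  · intro i j k a b; simpa [eq_comm] using h1 _ _ _ (α.iseqv.symm a) b
  · intro i j k a b; simpa [eq_comm] using h1 _ _ _ a b
  · intro a b c d h3 h4 h5 h6 h7
    exact h2 _ _ _ _ h3 h4 h5 h6 h7
  · intro a b c d h3 h4 h5 h6 h7
    rw [Fin.lt_def] at *
    exact h2 _ _ _ _ (α.iseqv.symm h4) (α.iseqv.symm h3) (by simp only [vpos]; omega)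
      (by simp only [vpos]; omega) (by simp only [vpos]; omega)
  · intro a b c d h3 h4 h5 h6
    rw [Fin.lt_def] at *
    exact h2 _ _ _ _ h3 h4 h5 h6 (by simp only [vpos]; omega)
  · intro a b c d h3 h4 h5 h6
    rw [Fin.lt_def] at *
    exact h2 _ _ _ _ h4 (α.iseqv.symm h3) (by simp only [vpos]; omega)
      (by simp only [vpos]; omega) (by simp only [vpos]; omega)
  · intro a b c d h3 h4 h5
    by_contra hc
    have hbd : b ≠ d := by
      rintro rfl
      have := h1 _ _ _ (α.iseqv.symm h3) (α.iseqv.symm h4)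
      simp at this
      exact absurd this h5.ne
    have : d < b := lt_of_le_of_ne (not_lt.1 hc) hbd.symm
    rw [Fin.lt_def] at *
    exact h2 _ _ _ _ h3 h4 h5 (by simp only [vpos]; omega) (by simp only [vpos]; omega)

theorem pmul_eq {α β γ : Dgm n}
    (b1 : ∀ p q, β.r (Sum.inr p) (Sum.inr q) → p = q)
    (b2 : ∀ i j, β.r (Sum.inl i) (Sum.inl j) → α.r (Sum.inl i) (Sum.inl j))
    (c1 : ∀ p q, γ.r (Sum.inl p) (Sum.inl q) → p ≠ q → ∃ i j, β.r (Sum.inl i) (Sum.inr p) ∧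
      β.r (Sum.inl j) (Sum.inr q) ∧ α.r (Sum.inl i) (Sum.inl j))
    (c2 : ∀ p j, γ.r (Sum.inl p) (Sum.inr j) → (∀ i, ¬ β.r (Sum.inl i) (Sum.inr p)) ∨
      ∃ i, β.r (Sum.inl i) (Sum.inr p) ∧ α.r (Sum.inl i) (Sum.inr j))
    (c3 : ∀ p q, γ.r (Sum.inr p) (Sum.inr q) ↔ α.r (Sum.inr p) (Sum.inr q))
    (a1 : ∀ i j, α.r (Sum.inl i) (Sum.inl j) → β.r (Sum.inl i) (Sum.inl j) ∨
      ∃ p q, β.r (Sum.inl i) (Sum.inr p) ∧ γ.r (Sum.inl p) (Sum.inl q) ∧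
        β.r (Sum.inl j) (Sum.inr q))
    (a2 : ∀ i j, α.r (Sum.inl i) (Sum.inr j) → ∃ p, β.r (Sum.inl i) (Sum.inr p) ∧
      γ.r (Sum.inl p) (Sum.inr j)) : α = pmul β γ := by
  let φ : V3 n → PBV n := fun v => match v with
    | Sum.inl i => Sum.inl i
    | Sum.inr (Sum.inl p) =>
      if h : ∃ i, β.r (Sum.inl i) (Sum.inr p) then Sum.inl h.choose
      else if h : ∃ j, γ.r (Sum.inl p) (Sum.inr j) then Sum.inr h.choose else Sum.inl p
    | Sum.inr (Sum.inr i) => Sum.inr i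
  have hφ1 : ∀ i p, β.r (Sum.inl i) (Sum.inr p) → α.r (Sum.inl i) (φ (Sum.inr (Sum.inl p))) := by
    intro i p h
    have hex : ∃ i, β.r (Sum.inl i) (Sum.inr p) := ⟨i, h⟩
    simp only [φ, dif_pos hex]
    exact b2 _ _ (β.iseqv.trans h (β.iseqv.symm hex.choose_spec))
  have hφ2 : ∀ p j, γ.r (Sum.inl p) (Sum.inr j) → α.r (φ (Sum.inr (Sum.inl p))) (Sum.inr j) := by
    intro p j h
    rcases c2 p j h with h' | ⟨i, h1, h2⟩
    · have hex : ¬ ∃ i, β.r (Sum.inl i) (Sum.inr p) := by simpa using h'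
      have hex2 : ∃ j, γ.r (Sum.inl p) (Sum.inr j) := ⟨j, h⟩
      simp only [φ, dif_neg hex, dif_pos hex2]
      exact (c3 _ _).1 (γ.iseqv.trans (γ.iseqv.symm hex2.choose_spec) h)
    · exact α.iseqv.trans (α.iseqv.symm (hφ1 i p h1)) h2
  have hφ : ∀ x y, RGen (prodEdges β γ) x y → α.r (φ x) (φ y) := by
    intro x y h
    induction h with
    | rel h =>
      rcases h with ⟨u, v, h, rfl, rfl⟩ | ⟨u, v, h, rfl, rfl⟩
      · rcases u with u | u <;> rcases v with v | v
        · exact b2 _ _ h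
        · exact hφ1 _ _ h
        · exact α.iseqv.symm (hφ1 _ _ (β.iseqv.symm h))
        · have e := b1 _ _ h; subst e; exact α.iseqv.refl _
      · rcases u with u | u <;> rcases v with v | v
        · by_cases e : u = v
          · subst e; exact α.iseqv.refl _
          · obtain ⟨i, j, h1, h2, h3⟩ := c1 _ _ h e
            exact α.iseqv.trans (α.iseqv.symm (hφ1 _ _ h1)) (α.iseqv.trans h3 (hφ1 _ _ h2))
        · exact hφ2 _ _ h
        · exact α.iseqv.symm (hφ2 _ _ (γ.iseqv.symm h))
        · exact (c3 _ _).1 h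
    | refl x => exact α.iseqv.refl _
    | symm _ ih => exact α.iseqv.symm ih
    | trans _ _ i1 i2 => exact α.iseqv.trans i1 i2
  have eβ : ∀ u v, β.r u v → RGen (prodEdges β γ) (topMid u) (topMid v) := fun u v h =>
    RGen.rel (Or.inl ⟨u, v, h, rfl, rfl⟩)
  have eγ : ∀ u v, γ.r u v → RGen (prodEdges β γ) (midBot u) (midBot v) := fun u v h =>
    RGen.rel (Or.inr ⟨u, v, h, rfl, rfl⟩)
  have e2 : ∀ i j, α.r (Sum.inl i) (Sum.inr j) →
      RGen (prodEdges β γ) (Sum.inl i) (Sum.inr (Sum.inr j)) := by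
    intro i j h
    obtain ⟨p, h1, h2⟩ := a2 _ _ h
    exact (eβ _ _ h1).trans (eγ _ _ h2)
  apply Setoid.ext
  intro x y
  constructor
  · intro h
    change RGen (prodEdges β γ) (topBot x) (topBot y)
    rcases x with x | x <;> rcases y with y | y
    · rcases a1 _ _ h with h | ⟨p, q, h1, h2, h3⟩
      · exact eβ _ _ h
      · exact (eβ _ _ h1).trans ((eγ _ _ h2).trans (eβ _ _ h3).symm)
    · exact e2 _ _ h
    · exact (e2 _ _ (α.iseqv.symm h)).symm
    · exact eγ _ _ ((c3 _ _).2 h)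
  · intro h
    have := hφ _ _ h
    rcases x with x | x <;> rcases y with y | y <;> exact this

/-! ### duality -/

theorem swap_swap (x : PBV n) : swapUD (swapUD x) = x := by rcases x with x | x <;> rfl

theorem pstar_rel (α : Dgm n) (x y : PBV n) : (pstar α).r x y ↔ α.r (swapUD x) (swapUD y) := Iff.rfl

theorem pstar_pstar (α : Dgm n) : pstar (pstar α) = α := by
  apply Setoid.ext
  intro x y
  change α.r (swapUD (swapUD x)) (swapUD (swapUD y)) ↔ α.r x y
  rw [swap_swap, swap_swap]

def sw3 : V3 n → V3 n
  | Sum.inl i => Sum.inr (Sum.inr i)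
  | Sum.inr (Sum.inl i) => Sum.inr (Sum.inl i)
  | Sum.inr (Sum.inr i) => Sum.inl i

theorem rgen_star {α β : Dgm n} {x y : V3 n} (h : RGen (prodEdges α β) x y) :
    RGen (prodEdges (pstar β) (pstar α)) (sw3 x) (sw3 y) := by
  induction h with
  | rel h =>
    apply RGen.rel
    rcases h with ⟨u, v, h, rfl, rfl⟩ | ⟨u, v, h, rfl, rfl⟩
    · right
      refine ⟨swapUD u, swapUD v, ?_, ?_, ?_⟩
      · rw [pstar_rel, swap_swap, swap_swap]; exact h
      · rcases u with u | u <;> rfl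
      · rcases v with v | v <;> rfl
    · left
      refine ⟨swapUD u, swapUD v, ?_, ?_, ?_⟩
      · rw [pstar_rel, swap_swap, swap_swap]; exact h
      · rcases u with u | u <;> rfl
      · rcases v with v | v <;> rfl
  | refl x => exact RGen.refl _
  | symm _ ih => exact ih.symm
  | trans _ _ i1 i2 => exact i1.trans i2

theorem sw3_topBot (x : PBV n) : sw3 (topBot x) = topBot (swapUD x) := by
  rcases x with x | x <;> rfl

theorem pstar_pmul (α β : Dgm n) : pstar (pmul α β) = pmul (pstar β) (pstar α) := by
  apply Setoid.ext
  intro x y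
  change RGen (prodEdges α β) (topBot (swapUD x)) (topBot (swapUD y)) ↔
    RGen (prodEdges (pstar β) (pstar α)) (topBot x) (topBot y)
  constructor
  · intro h
    have := rgen_star h
    rwa [sw3_topBot, sw3_topBot, swap_swap, swap_swap] at this
  · intro h
    have := rgen_star h
    rwa [sw3_topBot, sw3_topBot, pstar_pstar, pstar_pstar] at this

theorem pstar_mem {α : Dgm n} (h : α ∈ Mset n) : pstar α ∈ Mset n := by
  have g := good_of h
  refine ⟨?_, ?_⟩
  · intro x y z h1 h2
    have inj : ∀ x y : PBV n, swapUD x = swapUD y → x = y := fun x y h => by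
      rw [← swap_swap x, h, swap_swap]
    rcases h.1 _ _ _ h1 h2 with h | h | h
    · exact Or.inl (inj _ _ h)
    · exact Or.inr (Or.inl (inj _ _ h))
    · exact Or.inr (Or.inr (inj _ _ h))
  · have hs : ∀ x : PBV n, vpos (swapUD x) = 2 * n - 1 - vpos x ∧ vpos x < 2 * n := by
      rintro (x | x)
      · have := x.2
        exact ⟨rfl, by simp only [vpos]; omega⟩
      · have := x.2
        refine ⟨?_, by simp only [vpos]; omega⟩
        change (x : ℕ) = 2 * n - 1 - (2 * n - 1 - x)
        omega
    intro a b c d h1 h2 h3 h4 h5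
    have a1 := hs a
    have b1 := hs b
    have c1 := hs c
    have d1 := hs d
    exact h.2 _ _ _ _ (α.iseqv.symm h2) (α.iseqv.symm h1) (by omega) (by omega) (by omega)

theorem prank_star {α : Dgm n} (h : α ∈ Mset n) : prank (pstar α) = prank α := by
  have g := good_of h
  unfold prank
  symm
  apply Set.ncard_congr (fun i (hi : i ∈ domSet α) => hi.choose)
  · intro i hi
    exact ⟨i, α.iseqv.symm hi.choose_spec⟩
  · intro i j hi hj e
    have h1 := hi.choose_spec
    have h2 := hj.choose_spec
    rw [← e] at h2
    exact g.tt' _ _ _ h1 h2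
  · rintro j ⟨i, hi⟩
    have hi' : α.r (Sum.inl i) (Sum.inr j) := α.iseqv.symm hi
    have hd : i ∈ domSet α := ⟨j, hi'⟩
    exact ⟨i, hd, g.tt _ _ _ hd.choose_spec hi'⟩

theorem pstar_DM {k : ℕ} {α : Dgm n} (h : α ∈ DM n k) : pstar α ∈ DM n k :=
  ⟨pstar_mem h.1, by rw [prank_star h.1]; exact h.2⟩

theorem exists_notMem' (S : Set (Fin n)) (h : S.ncard < n) : ∃ x, x ∉ S := by
  by_contra hc
  push Not at hc
  have : S = Set.univ := Set.eq_univ_of_forall hc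
  rw [this, Set.ncard_univ, Nat.card_eq_fintype_card, Fintype.card_fin] at h
  exact lt_irrefl _ h

theorem good_id (U : Fin n → Fin n → Prop) (P : Fin n → Prop)
    (ur : ∀ i, U i i) (us : ∀ i j, U i j → U j i)
    (um : ∀ i j k, U i j → U i k → i = j ∨ i = k ∨ j = k)
    (pu : ∀ a b c d, U a b → U c d → a < c → c < b → b < d → False)
    (tu : ∀ i k, P i → U i k → k = i)
    (put : ∀ a b c, U a b → P c → a < c → c < b → False) :
    Good U (fun i j => i = j ∧ P i) (fun i j => i = j) where
  ur := ur
  us := us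
  um := um
  lr := fun i => rfl
  ls := fun i j h => h.symm
  lm := fun i j k h _ => Or.inl h
  tu := fun i j k h => tu i k h.2
  tl := fun i j k _ h => h.symm
  tt := fun i j k h h' => h.1.symm.trans h'.1
  pu := pu
  pl := fun a b c d h _ h1 h2 _ => absurd (h1.trans h2) (by simp [h])
  put := fun a b c d h h' => put a b c h h'.2
  plt := fun a b c d h _ h1 h2 => absurd (h1.trans h2) (by simp [h])
  pt := fun a b c d h h' hlt => by rw [← h.1, ← h'.1]; exact hlt

/-- replace the upper part by an arbitrary compatible one -/
theorem good_upper {U T L : Fin n → Fin n → Prop} (g : Good U T L) (U' : Fin n → Fin n → Prop)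
    (ur : ∀ i, U' i i) (us : ∀ i j, U' i j → U' j i)
    (um : ∀ i j k, U' i j → U' i k → i = j ∨ i = k ∨ j = k)
    (pu : ∀ a b c d, U' a b → U' c d → a < c → c < b → b < d → False)
    (tu : ∀ i j k, T i j → U' i k → k = i)
    (put : ∀ a b c d, U' a b → T c d → a < c → c < b → False) : Good U' T L where
  ur := ur
  us := us
  um := um
  lr := g.lr
  ls := g.ls
  lm := g.lm
  tu := tu
  tl := g.tl
  tt := g.tt
  pu := pu
  pl := g.pl
  put := put
  plt := g.plt
  pt := g.pt

theorem good_eq {T : Fin n → Fin n → Prop} (tt : ∀ i j k, T i j → T i k → j = k)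
    (pt : ∀ a b c d, T a b → T c d → a < c → b < d) :
    Good (fun i j => i = j) T (fun i j => i = j) where
  ur := fun i => rfl
  us := fun i j h => h.symm
  um := fun i j k h _ => Or.inl h
  lr := fun i => rfl
  ls := fun i j h => h.symm
  lm := fun i j k h _ => Or.inl h
  tu := fun i j k _ h => h.symm
  tl := fun i j k _ h => h.symm
  tt := tt
  pu := fun a b c d h _ h1 h2 _ => absurd (h1.trans h2) (by simp [h])
  pl := fun a b c d h _ h1 h2 _ => absurd (h1.trans h2) (by simp [h])
  put := fun a b c d h _ h1 h2 => absurd (h1.trans h2) (by simp [h])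
  plt := fun a b c d h _ h1 h2 => absurd (h1.trans h2) (by simp [h])
  pt := pt

def UpTriv (α : Dgm n) : Prop := ∀ i j, α.r (Sum.inl i) (Sum.inl j) → i = j
def LoTriv (α : Dgm n) : Prop := ∀ i j, α.r (Sum.inr i) (Sum.inr j) → i = j

def Closed (X : Set (Dgm n)) : Prop := ∀ a b, a ∈ X → b ∈ X → pmul a b ∈ X

theorem poi_base {k : ℕ} {X : Set (Dgm n)} (hX : Closed X) (hk : k + 2 ≤ n)
    (h1 : DM n (k + 1) ⊆ X) {α : Dgm n} (hα : α ∈ DM n k) (hU : UpTriv α) (hL : LoTriv α)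
    (hT : ∀ i j, α.r (Sum.inl i) (Sum.inr j) → i = j) : α ∈ X := by
  have hr : (domSet α).ncard = k := hα.2
  obtain ⟨x, hx⟩ := exists_notMem' (domSet α) (by omega)
  obtain ⟨y, hy⟩ := exists_notMem' (insert x (domSet α)) (by
    have := Set.ncard_insert_le x (domSet α); omega)
  have hyx : y ≠ x := fun h => hy (by simp [h])
  have hyd : y ∉ domSet α := fun h => hy (by simp [h])
  have gd : ∀ z, Good (n := n) (fun i j => i = j) (fun i j => i = j ∧ (i ∈ domSet α ∨ i = z))
      (fun i j => i = j) := fun z => good_eq (fun i j k h h' => h.1.symm.trans h'.1)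
        (fun a b c d h h' hlt => by rw [← h.1, ← h'.1]; exact hlt)
  have mem : ∀ z, z ∉ domSet α → mkD _ _ _ (gd z) ∈ X := by
    intro z hz
    apply h1
    refine ⟨mkD_mem _, ?_⟩
    have : domSet (mkD _ _ _ (gd z)) = insert z (domSet α) := by
      ext i
      constructor
      · rintro ⟨j, h⟩
        have h : i = j ∧ (i ∈ domSet α ∨ i = z) := h
        rcases h.2 with h | h
        · exact Or.inr h
        · exact Or.inl h
      · intro h
        have h : i = z ∨ i ∈ domSet α := h
        exact ⟨i, rfl, h.symm⟩
    unfold prank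
    rw [this, Set.ncard_insert_of_notMem hz, hr]
  have hd : ∀ i ∈ domSet α, α.r (Sum.inl i) (Sum.inr i) := by
    rintro i ⟨j, h⟩
    have := hT _ _ h
    subst this
    exact h
  have e : α = pmul (mkD _ _ _ (gd x)) (mkD _ _ _ (gd y)) := by
    apply pmul_eq
    · intro p q h; exact h
    · intro i j h
      have h : i = j := h
      subst h; exact α.iseqv.refl _
    · intro p q h hne; exact absurd h hne
    · intro p j h
      have h : p = j ∧ (p ∈ domSet α ∨ p = y) := h
      obtain ⟨rfl, h | h⟩ := h
      · right
        exact ⟨p, ⟨rfl, Or.inl h⟩, hd p h⟩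
      · left
        intro i hi
        have hi : i = p ∧ (i ∈ domSet α ∨ i = x) := hi
        obtain ⟨rfl, h' | h'⟩ := hi
        · exact hyd (h ▸ h')
        · exact hyx (h.symm.trans h')
    · intro p q
      constructor
      · intro h
        have h : p = q := h
        subst h; exact α.iseqv.refl _
      · intro h; exact hL _ _ h
    · intro i j h
      left; exact hU _ _ h
    · intro i j h
      have := hT _ _ h
      subst this
      exact ⟨i, ⟨rfl, Or.inl ⟨i, h⟩⟩, ⟨rfl, Or.inl ⟨i, h⟩⟩⟩
  rw [e]
  exact hX _ _ (mem x hx) (mem y hyd)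

/-- the measure for the induction -/
def mu (α : Dgm n) : ℕ :=
  (∑ i : Fin n, if i ∈ domSet α then (i : ℕ) else 0) +
  ∑ i : Fin n, if i ∈ codomSet α then (i : ℕ) else 0

theorem mu_star (α : Dgm n) : mu (pstar α) = mu α := by
  unfold mu
  rw [add_comm]
  rfl

theorem poi_shift {k : ℕ} {X : Set (Dgm n)} (hX : Closed X) (hk : k + 2 ≤ n)
    (h1 : DM n (k + 1) ⊆ X) {α : Dgm n} (hα : α ∈ DM n k) (hU : UpTriv α) (hL : LoTriv α)
    (hT : ∃ i j, α.r (Sum.inl i) (Sum.inr j) ∧ j < i)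
    (ih : ∀ γ ∈ DM n k, UpTriv γ → LoTriv γ → mu γ < mu α → γ ∈ X) : α ∈ X := by
  have hr : (domSet α).ncard = k := hα.2
  have g := good_of hα.1
  -- least such point
  obtain ⟨a, b, hab, hba, hmin⟩ : ∃ a b, α.r (Sum.inl a) (Sum.inr b) ∧ b < a ∧
      ∀ i < a, ∀ j, α.r (Sum.inl i) (Sum.inr j) → i ≤ j := by
    obtain ⟨a, ha⟩ := exists_minimal_of_wellFoundedLT
      (fun i : Fin n => ∃ j, α.r (Sum.inl i) (Sum.inr j) ∧ j < i) hT
    obtain ⟨b, hab, hba⟩ := ha.1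
    refine ⟨a, b, hab, hba, fun i hi j hij => ?_⟩
    by_contra hc
    exact absurd (ha.2 ⟨j, hij, not_le.1 hc⟩ hi.le) (not_le.2 hi)
  have hba' : (b : ℕ) < a := hba
  obtain ⟨c, hc⟩ : ∃ c : Fin n, (c : ℕ) + 1 = a := ⟨⟨a - 1, by omega⟩, by simp; omega⟩
  have hca : c < a := by rw [Fin.lt_def]; omega
  have hcd : c ∉ domSet α := by
    rintro ⟨j, hj⟩
    have e1 : c ≤ j := hmin c hca j hj
    have e2 : j < b := g.pt _ _ _ _ hj hab hca
    rw [Fin.lt_def] at e2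
    rw [Fin.le_def] at e1
    omega
  have had : a ∈ domSet α := ⟨b, hab⟩
  obtain ⟨x, hx⟩ := exists_notMem' (insert c (domSet α)) (by
    have := Set.ncard_insert_le c (domSet α); omega)
  have hxc : x ≠ c := fun h => hx (by simp [h])
  have hxd : x ∉ domSet α := fun h => hx (by simp [h])
  have hxa : x ≠ a := fun h => hxd (h ▸ had)
  let T1 : Fin n → Fin n → Prop := fun i j =>
    (i = j ∧ i ≠ a ∧ (i ∈ domSet α ∨ i = x)) ∨ (i = a ∧ j = c)
  have nc : ∀ i, i ≠ a → (i ∈ domSet α ∨ i = x) → i < c ∨ a < i := by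
    intro i h1 h2
    have h3 : i ≠ c := by
      rintro rfl
      rcases h2 with h | h
      · exact hcd h
      · exact hxc h.symm
    rw [Fin.lt_def, Fin.lt_def]
    rw [Ne, Fin.ext_iff] at h1 h3
    omega
  have gβ : Good (fun i j => i = j) T1 (fun i j => i = j) := by
    apply good_eq
    · rintro i j l (⟨h1, h2, h3⟩ | ⟨h1, h2⟩) (⟨h4, h5, h6⟩ | ⟨h4, h5⟩)
      · exact h1.symm.trans h4
      · exact absurd h4 h2
      · exact absurd h1 h5
      · exact h2.trans h5.symm
    · rintro i j l m (⟨h1, h2, h3⟩ | ⟨h1, h2⟩) (⟨h4, h5, h6⟩ | ⟨h4, h5⟩) hlt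
      · rw [← h1, ← h4]; exact hlt
      · rw [← h1, h5]
        rcases nc i h2 h3 with h | h
        · exact h
        · rw [h4] at hlt; exact absurd (h.trans hlt) (lt_irrefl _)
      · rw [h2, ← h4]
        rw [h1] at hlt; exact hca.trans hlt
      · rw [h1, h4] at hlt; exact absurd hlt (lt_irrefl _)
  let T2 : Fin n → Fin n → Prop := fun i j =>
    (i ≠ a ∧ α.r (Sum.inl i) (Sum.inr j)) ∨ (i = c ∧ j = b)
  have gγ : Good (fun i j => i = j) T2 (fun i j => i = j) := by
    apply good_eq
    · rintro i j l (⟨h1, h2⟩ | ⟨h1, h2⟩) (⟨h4, h5⟩ | ⟨h4, h5⟩)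
      · exact g.tt _ _ _ h2 h5
      · subst h4; exact absurd ⟨_, h2⟩ hcd
      · subst h1; exact absurd ⟨_, h5⟩ hcd
      · exact h2.trans h5.symm
    · rintro i j l m (⟨h1, h2⟩ | ⟨h1, h2⟩) (⟨h4, h5⟩ | ⟨h4, h5⟩) hlt
      · exact g.pt _ _ _ _ h2 h5 hlt
      · rw [h5]
        exact g.pt _ _ _ _ h2 hab (by rw [h4] at hlt; exact hlt.trans hca)
      · rw [h2]
        refine g.pt _ _ _ _ hab h5 ?_
        rcases nc l h4 (Or.inl ⟨_, h5⟩) with h | h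
        · rw [h1] at hlt; exact absurd (h.trans hlt) (lt_irrefl _)
        · exact h
      · rw [h1, h4] at hlt; exact absurd hlt (lt_irrefl _)
  have dβ : domSet (mkD _ _ _ gβ) = insert x (domSet α) := by
    ext i
    constructor
    · rintro ⟨j, ⟨h1, h2, h3⟩ | ⟨h1, h2⟩⟩
      · exact h3.symm
      · rw [h1]; exact Or.inr had
    · intro h
      by_cases hi : i = a
      · exact ⟨c, Or.inr ⟨hi, rfl⟩⟩
      · exact ⟨i, Or.inl ⟨rfl, hi, Or.symm h⟩⟩
  have dγ : ∀ i, i ∈ domSet (mkD _ _ _ gγ) ↔ i = c ∨ (i ≠ a ∧ i ∈ domSet α) := by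
    intro i
    constructor
    · rintro ⟨j, ⟨h1, h2⟩ | ⟨h1, h2⟩⟩
      · exact Or.inr ⟨h1, _, h2⟩
      · exact Or.inl h1
    · rintro (h | ⟨h, j, h'⟩)
      · exact ⟨b, Or.inr ⟨h, rfl⟩⟩
      · exact ⟨j, Or.inl ⟨h, h'⟩⟩
  have cγ : ∀ j, j ∈ codomSet (mkD _ _ _ gγ) ↔ j ∈ codomSet α := by
    intro j
    constructor
    · rintro ⟨i, ⟨h1, h2⟩ | ⟨h1, h2⟩⟩
      · exact ⟨i, α.iseqv.symm h2⟩
      · exact ⟨a, by rw [h2]; exact α.iseqv.symm hab⟩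
    · rintro ⟨i, h⟩
      have h' := α.iseqv.symm h
      by_cases hi : i = a
      · subst hi
        exact ⟨c, Or.inr ⟨rfl, g.tt _ _ _ h' hab⟩⟩
      · exact ⟨i, Or.inl ⟨hi, h'⟩⟩
  have mβ : mkD _ _ _ gβ ∈ X := by
    apply h1
    refine ⟨mkD_mem _, ?_⟩
    unfold prank
    rw [dβ, Set.ncard_insert_of_notMem hxd, hr]
  have mγ : mkD _ _ _ gγ ∈ X := by
    apply ih
    · refine ⟨mkD_mem _, ?_⟩
      unfold prank
      have : domSet (mkD _ _ _ gγ) = insert c (domSet α \ {a}) := by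
        ext i
        rw [dγ]
        simp only [Set.mem_insert_iff, Set.mem_sdiff, Set.mem_singleton_iff]
        tauto
      rw [this, Set.ncard_insert_of_notMem (fun h => hcd h.1),
        Set.ncard_sdiff_singleton_add_one had, hr]
    · intro i j h; exact h
    · intro i j h; exact h
    · unfold mu
      simp only [cγ]
      apply Nat.add_lt_add_right
      have e1 : ∀ f : Fin n → ℕ, ∑ i, f i = f a + f c + ∑ i ∈ (Finset.univ.erase a).erase c, f i := by
        intro f
        rw [← Finset.add_sum_erase _ f (Finset.mem_univ a),
          ← Finset.add_sum_erase _ f (Finset.mem_erase.2 ⟨hca.ne, Finset.mem_univ c⟩), add_assoc]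
      rw [e1, e1 (fun i => if i ∈ domSet α then (i : ℕ) else 0)]
      apply add_lt_add_of_lt_of_le
      · have q1 : a ∉ domSet (mkD _ _ _ gγ) := by
          rw [dγ]; rintro (h | h)
          · exact hca.ne h.symm
          · exact h.1 rfl
        have q2 : c ∈ domSet (mkD _ _ _ gγ) := by rw [dγ]; exact Or.inl rfl
        simp only [q1, q2, had, hcd, if_true, if_false]
        omega
      · apply le_of_eq
        apply Finset.sum_congr rfl
        intro i hi
        simp only [Finset.mem_erase] at hi
        have : i ∈ domSet (mkD _ _ _ gγ) ↔ i ∈ domSet α := by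
          rw [dγ]; tauto
        simp only [this]
  have e : α = pmul (mkD _ _ _ gβ) (mkD _ _ _ gγ) := by
    apply pmul_eq
    · intro p q h; exact h
    · intro i j h
      have h : i = j := h
      subst h; exact α.iseqv.refl _
    · intro p q h hne; exact absurd h hne
    · rintro p j (⟨h1, h2⟩ | ⟨h1, h2⟩)
      · right; exact ⟨p, Or.inl ⟨rfl, h1, Or.inl ⟨j, h2⟩⟩, h2⟩
      · right; exact ⟨a, Or.inr ⟨rfl, h1⟩, h2 ▸ hab⟩
    · intro p q
      constructor
      · intro h
        have h : p = q := h
        subst h; exact α.iseqv.refl _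
      · intro h; exact hL _ _ h
    · intro i j h
      left; exact hU _ _ h
    · intro i j h
      by_cases hi : i = a
      · subst hi
        exact ⟨c, Or.inr ⟨rfl, rfl⟩, Or.inr ⟨rfl, g.tt _ _ _ h hab⟩⟩
      · exact ⟨i, Or.inl ⟨rfl, hi, Or.inl ⟨j, h⟩⟩, Or.inl ⟨hi, h⟩⟩
  rw [e]
  exact hX _ _ mβ mγ

def dual (X : Set (Dgm n)) : Set (Dgm n) := {α | pstar α ∈ X}

theorem dual_closed {X : Set (Dgm n)} (hX : Closed X) : Closed (dual X) := by
  intro a b ha hb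
  change pstar _ ∈ X
  rw [pstar_pmul]
  exact hX _ _ hb ha

theorem dual_DM {X : Set (Dgm n)} {k : ℕ} (h : DM n k ⊆ X) : DM n k ⊆ dual X :=
  fun _ ha => h (pstar_DM ha)

theorem poi_mem {k : ℕ} (hk : k + 2 ≤ n) {X : Set (Dgm n)} (hX : Closed X)
    (h1 : DM n (k + 1) ⊆ X) {α : Dgm n} (hα : α ∈ DM n k) (hU : UpTriv α) (hL : LoTriv α) :
    α ∈ X := by
  have main : ∀ m, ∀ α ∈ DM n k, UpTriv α → LoTriv α → mu α = m → α ∈ X := by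
    intro m
    induction m using Nat.strong_induction_on with
    | _ m ihm =>
    intro α hα hU hL hm
    have ih : ∀ γ ∈ DM n k, UpTriv γ → LoTriv γ → mu γ < mu α → γ ∈ X := fun γ hγ a b c =>
      ihm _ (hm ▸ c) γ hγ a b rfl
    by_cases c1 : ∃ i j, α.r (Sum.inl i) (Sum.inr j) ∧ j < i
    · exact poi_shift hX hk h1 hα hU hL c1 ih
    by_cases c2 : ∃ i j, α.r (Sum.inl i) (Sum.inr j) ∧ i < j
    · have : pstar α ∈ dual X := by
        apply poi_shift (dual_closed hX) hk (dual_DM h1) (pstar_DM hα) hL hU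
        · obtain ⟨i, j, h, hlt⟩ := c2
          exact ⟨j, i, α.iseqv.symm h, hlt⟩
        · intro γ hγ a b c
          exact ih _ (pstar_DM hγ) b a (by rwa [mu_star] at c ⊢)
      have this : pstar (pstar α) ∈ X := this
      rwa [pstar_pstar] at this
    · push Not at c1 c2
      exact poi_base hX hk h1 hα hU hL (fun i j h => le_antisymm (c1 i j h) (c2 i j h))
  exact main _ α hα hU hL rfl

/-- the singleton case -/
theorem peel_single {k : ℕ} {X : Set (Dgm n)} (hX : Closed X)
    (h1 : DM n (k + 1) ⊆ X) {α : Dgm n} (hα : α ∈ DM n k) (w : Fin n) (hw : w ∉ domSet α)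
    (hw1 : ∀ j, α.r (Sum.inl w) (Sum.inl j) → j = w)
    (hw2 : ∀ a b, α.r (Sum.inl a) (Sum.inl b) → a < w → w < b → False)
    (ih : ∀ γ ∈ DM n k, UpTriv γ →
      (∀ p q, γ.r (Sum.inr p) (Sum.inr q) ↔ α.r (Sum.inr p) (Sum.inr q)) → γ ∈ X) : α ∈ X := by
  have hr : (domSet α).ncard = k := hα.2
  have g := good_of hα.1
  have gβ := good_id (fun i j => α.r (Sum.inl i) (Sum.inl j)) (fun i => i ∈ domSet α ∨ i = w)
    g.ur g.us g.um g.pu (by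
      rintro i l (⟨j, h⟩ | rfl) h'
      · exact g.tu _ _ _ h h'
      · exact hw1 _ h') (by
      rintro a b c h (⟨d, h'⟩ | rfl)
      · exact g.put _ _ _ _ h h'
      · exact hw2 _ _ h)
  have gγ := good_upper g (fun i j => i = j) (fun _ => rfl) (fun _ _ h => h.symm)
    (fun i j k h _ => Or.inl h) (fun a b c d h _ h1 h2 _ => absurd (h1.trans h2) (by simp [h]))
    (fun i j k _ h => h.symm) (fun a b c d h _ h1 h2 => absurd (h1.trans h2) (by simp [h]))
  have mβ : mkD _ _ _ gβ ∈ X := by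
    apply h1
    refine ⟨mkD_mem _, ?_⟩
    have : domSet (mkD _ _ _ gβ) = insert w (domSet α) := by
      ext i
      constructor
      · rintro ⟨j, h⟩
        exact Or.symm h.2
      · intro h
        exact ⟨i, rfl, Or.symm h⟩
    unfold prank
    rw [this, Set.ncard_insert_of_notMem hw, hr]
  have mγ : mkD _ _ _ gγ ∈ X := by
    apply ih
    · exact ⟨mkD_mem _, hr⟩
    · intro i j h; exact h
    · intro p q; exact Iff.rfl
  have e : α = pmul (mkD _ _ _ gβ) (mkD _ _ _ gγ) := by
    apply pmul_eq
    · intro p q h; exact h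
    · intro i j h; exact h
    · intro p q h hne; exact absurd h hne
    · intro p j h
      right; exact ⟨p, ⟨rfl, Or.inl ⟨j, h⟩⟩, h⟩
    · intro p q; exact Iff.rfl
    · intro i j h; left; exact h
    · intro i j h
      exact ⟨i, ⟨rfl, Or.inl ⟨j, h⟩⟩, h⟩
  rw [e]
  exact hX _ _ mβ mγ

theorem peel {k : ℕ} (hk : k + 3 ≤ n) {X : Set (Dgm n)} (hX : Closed X)
    (h1 : DM n (k + 1) ⊆ X) (h2 : DM n (k + 2) ⊆ X) {α : Dgm n} (hα : α ∈ DM n k)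
    (ih : ∀ γ ∈ DM n k, UpTriv γ →
      (∀ p q, γ.r (Sum.inr p) (Sum.inr q) ↔ α.r (Sum.inr p) (Sum.inr q)) → γ ∈ X) : α ∈ X := by
  have hr : (domSet α).ncard = k := hα.2
  have g := good_of hα.1
  by_cases hU : UpTriv α
  · exact ih α hα hU (fun p q => Iff.rfl)
  have hex : ∃ u v, α.r (Sum.inl u) (Sum.inl v) ∧ u < v := by
    unfold UpTriv at hU
    push Not at hU
    obtain ⟨i, j, h, hne⟩ := hU
    rcases lt_or_gt_of_ne hne with h' | h'
    · exact ⟨i, j, h, h'⟩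
    · exact ⟨j, i, α.iseqv.symm h, h'⟩
  obtain ⟨u, v, huv, hlt, hmin⟩ : ∃ u v, α.r (Sum.inl u) (Sum.inl v) ∧ u < v ∧
      ∀ i < u, ∀ j, α.r (Sum.inl i) (Sum.inl j) → j ≤ i := by
    obtain ⟨a, ha⟩ := exists_minimal_of_wellFoundedLT
      (fun i : Fin n => ∃ j, α.r (Sum.inl i) (Sum.inl j) ∧ i < j) hex
    obtain ⟨b, hab, hba⟩ := ha.1
    refine ⟨a, b, hab, hba, fun i hi j hij => ?_⟩
    by_contra hc
    exact absurd (ha.2 ⟨j, hij, not_le.1 hc⟩ hi.le) (not_le.2 hi)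
  have hlt' : (u : ℕ) < v := hlt
  obtain ⟨s, hs⟩ : ∃ s : Fin n, (s : ℕ) = u + 1 := ⟨⟨u + 1, by omega⟩, rfl⟩
  have hus : u < s := by rw [Fin.lt_def]; omega
  have hsv : s ≤ v := by rw [Fin.le_def]; omega
  have hu : u ∉ domSet α := by
    rintro ⟨j, h⟩
    exact hlt.ne' (g.tu _ _ _ h huv)
  have hv : v ∉ domSet α := by
    rintro ⟨j, h⟩
    exact hlt.ne (g.tu _ _ _ h (α.iseqv.symm huv))
  have hdom : ∀ i ∈ domSet α, i < u ∨ v < i := by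
    rintro i ⟨j, h⟩
    by_contra hc
    push Not at hc
    have e1 : u ≠ i := by rintro rfl; exact hu ⟨j, h⟩
    have e2 : i ≠ v := by rintro rfl; exact hv ⟨j, h⟩
    exact g.put _ _ _ _ huv h (lt_of_le_of_ne hc.1 e1) (lt_of_le_of_ne hc.2 e2)
  have hsd : s ∉ domSet α := by
    intro h
    rcases hdom s h with h | h
    · exact absurd (h.trans hus) (lt_irrefl _)
    · exact absurd (lt_of_lt_of_le h hsv) (lt_irrefl _)
  -- partners
  have pu' : ∀ j, α.r (Sum.inl u) (Sum.inl j) → j = u ∨ j = v := by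
    intro j h
    rcases g.um _ _ _ huv h with h | h | h
    · exact absurd h hlt.ne
    · exact Or.inl h.symm
    · exact Or.inr h.symm
  have pv' : ∀ j, α.r (Sum.inl v) (Sum.inl j) → j = u ∨ j = v := by
    intro j h
    exact pu' j (α.iseqv.trans huv h)
  let U1 : Fin n → Fin n → Prop := fun i j =>
    i = j ∨ (α.r (Sum.inl i) (Sum.inl j) ∧ i ≠ u ∧ i ≠ v ∧ j ≠ u ∧ j ≠ v)
  have U1le : ∀ i j, U1 i j → α.r (Sum.inl i) (Sum.inl j) := by
    rintro i j (h | h)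
    · rw [h]
    · exact h.1
  let T1 : Fin n → Fin n → Prop := fun i j =>
    (i = j ∧ i ∈ domSet α) ∨ (i = u ∧ j = u) ∨ (i = v ∧ j = s)
  have gβ : Good U1 T1 (fun i j => i = j) := by
    refine ⟨fun i => Or.inl rfl, ?_, fun i j k a b => g.um _ _ _ (U1le _ _ a) (U1le _ _ b),
      fun i => rfl, fun i j h => h.symm, fun i j k h _ => Or.inl h, ?_, fun i j k _ h => h.symm,
      ?_, fun a b c d h h' => g.pu _ _ _ _ (U1le _ _ h) (U1le _ _ h'),
      fun a b c d h _ h1 h2 _ => absurd (h1.trans h2) (by simp [h]), ?_,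
      fun a b c d h _ h1 h2 => absurd (h1.trans h2) (by simp [h]), ?_⟩
    · rintro i j (h | ⟨h, h1, h2, h3, h4⟩)
      · exact Or.inl h.symm
      · exact Or.inr ⟨α.iseqv.symm h, h3, h4, h1, h2⟩
    · rintro i j k (⟨rfl, j, h⟩ | ⟨rfl, rfl⟩ | ⟨rfl, rfl⟩) h'
      · exact g.tu _ _ _ h (U1le _ _ h')
      · rcases h' with h' | h'
        · exact h'.symm
        · exact absurd rfl h'.2.1
      · rcases h' with h' | h'
        · exact h'.symm
        · exact absurd rfl h'.2.2.1
    · rintro i j k (⟨h1, h2⟩ | ⟨h1, h2⟩ | ⟨h1, h2⟩) (⟨h3, h4⟩ | ⟨h3, h4⟩ | ⟨h3, h4⟩)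
      · exact h1.symm.trans h3
      · exact absurd (h3 ▸ h2) hu
      · exact absurd (h3 ▸ h2) hv
      · exact absurd (h1 ▸ h4) hu
      · exact h2.trans h4.symm
      · exact absurd (h1.symm.trans h3) hlt.ne
      · exact absurd (h1 ▸ h4) hv
      · exact absurd (h3.symm.trans h1) hlt.ne
      · exact h2.trans h4.symm
    · rintro a b c d h h' h3 h4
      rcases h with h | ⟨h, n1, n2, n3, n4⟩
      · exact absurd (h3.trans h4) (by simp [h])
      rcases h' with ⟨h1, j, h2⟩ | ⟨h1, h2⟩ | ⟨h1, h2⟩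
      · exact g.put _ _ _ _ h h2 h3 h4
      · subst h1
        exact absurd (hmin a h3 b h) (not_le.2 (h3.trans h4))
      · subst h1
        rcases lt_trichotomy a u with h5 | h5 | h5
        · exact absurd (hmin a h5 b h) (not_le.2 (h3.trans h4))
        · exact n1 h5
        · exact g.pu _ _ _ _ huv h h5 h3 h4
    · rintro a b c d (⟨h1, h2⟩ | ⟨h1, h2⟩ | ⟨h1, h2⟩) (⟨h3, h4⟩ | ⟨h3, h4⟩ | ⟨h3, h4⟩) hlt2
      · rw [← h1, ← h3]; exact hlt2
      · rw [← h1, h4, ← h3]; exact hlt2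
      · rw [← h1, h4]
        rcases hdom a h2 with h | h
        · exact h.trans hus
        · rw [h3] at hlt2; exact absurd (h.trans hlt2) (lt_irrefl _)
      · rw [← h3, h2, ← h1]; exact hlt2
      · rw [h1, h3] at hlt2; exact absurd hlt2 (lt_irrefl _)
      · rw [h2, h4]; exact hus
      · rw [h2, ← h3]; rw [h1] at hlt2; exact lt_of_le_of_lt hsv hlt2
      · rw [h1, h3] at hlt2; exact absurd (hlt.trans hlt2) (lt_irrefl _)
      · rw [h1, h3] at hlt2; exact absurd hlt2 (lt_irrefl _)
  let W : Fin n → Fin n → Prop := fun i j =>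
    i = j ∨ (i = u ∧ j = s) ∨ (i = s ∧ j = u)
  have Wno : ∀ a b c, W a b → a < c → c < b → False := by
    rintro a b c (h | ⟨h, h'⟩ | ⟨h, h'⟩) h1 h2
    · exact absurd (h1.trans h2) (by simp [h])
    · subst h h'; rw [Fin.lt_def] at *; omega
    · subst h h'; rw [Fin.lt_def] at *; omega
  have gγ : Good W (fun i j => α.r (Sum.inl i) (Sum.inr j))
      (fun i j => α.r (Sum.inr i) (Sum.inr j)) := by
    apply good_upper g W
    · intro i; exact Or.inl rfl
    · rintro i j (h | ⟨h, h'⟩ | ⟨h, h'⟩)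
      · exact Or.inl h.symm
      · exact Or.inr (Or.inr ⟨h', h⟩)
      · exact Or.inr (Or.inl ⟨h', h⟩)
    · have := hus.ne
      rintro i j k (h | ⟨h, h'⟩ | ⟨h, h'⟩) (h1 | ⟨h1, h2⟩ | ⟨h1, h2⟩)
      · exact Or.inl h
      · exact Or.inl h
      · exact Or.inl h
      · exact Or.inr (Or.inl h1)
      · exact Or.inr (Or.inr (h'.trans h2.symm))
      · exact absurd (h.symm.trans h1) this
      · exact Or.inr (Or.inl h1)
      · exact absurd (h1.symm.trans h) this
      · exact Or.inr (Or.inr (h'.trans h2.symm))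
    · intro a b c d h _ h1 h2 _; exact Wno _ _ _ h h1 h2
    · rintro i j k h (h1 | ⟨h1, h2⟩ | ⟨h1, h2⟩)
      · exact h1.symm
      · exact absurd ⟨j, h1 ▸ h⟩ hu
      · exact absurd ⟨j, h1 ▸ h⟩ hsd
    · intro a b c d h _ h1 h2; exact Wno _ _ _ h h1 h2
  have mβ : mkD _ _ _ gβ ∈ X := by
    apply h2
    refine ⟨mkD_mem _, ?_⟩
    have : domSet (mkD _ _ _ gβ) = insert u (insert v (domSet α)) := by
      ext i
      constructor
      · rintro ⟨j, ⟨h1, h2⟩ | ⟨h1, h2⟩ | ⟨h1, h2⟩⟩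
        · exact Or.inr (Or.inr h2)
        · exact Or.inl h1
        · exact Or.inr (Or.inl h1)
      · rintro (h | h | h)
        · exact ⟨u, Or.inr (Or.inl ⟨h, rfl⟩)⟩
        · exact ⟨s, Or.inr (Or.inr ⟨h, rfl⟩)⟩
        · exact ⟨i, Or.inl ⟨rfl, h⟩⟩
    unfold prank
    rw [this, Set.ncard_insert_of_notMem, Set.ncard_insert_of_notMem hv, hr]
    rintro (h | h)
    · exact hlt.ne h
    · exact hu h
  have mγ : mkD _ _ _ gγ ∈ X := by
    obtain ⟨w, hw⟩ := exists_notMem' (insert u (insert s (domSet α))) (by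
      have := Set.ncard_insert_le u (insert s (domSet α))
      have := Set.ncard_insert_le s (domSet α)
      omega)
    have w1 : w ≠ u := fun h => hw (Or.inl h)
    have w2 : w ≠ s := fun h => hw (Or.inr (Or.inl h))
    have w3 : w ∉ domSet α := fun h => hw (Or.inr (Or.inr h))
    apply peel_single hX h1 (α := mkD _ _ _ gγ) ⟨mkD_mem _, hr⟩ w w3
    · rintro j (h | ⟨h, h'⟩ | ⟨h, h'⟩)
      · exact h.symm
      · exact absurd h w1
      · exact absurd h w2
    · intro a b h; exact Wno a b w h
    · intro γ h3 h4 h5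
      exact ih γ h3 h4 h5
  have e : α = pmul (mkD _ _ _ gβ) (mkD _ _ _ gγ) := by
    apply pmul_eq
    · intro p q h; exact h
    · intro i j h; exact U1le _ _ h
    · rintro p q (h | ⟨h, h'⟩ | ⟨h, h'⟩) hne
      · exact absurd h hne
      · exact ⟨u, v, Or.inr (Or.inl ⟨rfl, h⟩), Or.inr (Or.inr ⟨rfl, h'⟩), huv⟩
      · exact ⟨v, u, Or.inr (Or.inr ⟨rfl, h⟩), Or.inr (Or.inl ⟨rfl, h'⟩), α.iseqv.symm huv⟩
    · intro p j h
      right; exact ⟨p, Or.inl ⟨rfl, ⟨j, h⟩⟩, h⟩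
    · intro p q; exact Iff.rfl
    · intro i j h
      by_cases hij : i = j
      · left; exact Or.inl hij
      by_cases i1 : i = u
      · right
        have : j = v := by
          rcases pu' j (i1 ▸ h) with h' | h'
          · exact absurd (i1.trans h'.symm) hij
          · exact h'
        exact ⟨u, s, Or.inr (Or.inl ⟨i1, rfl⟩), Or.inr (Or.inl ⟨rfl, rfl⟩),
          Or.inr (Or.inr ⟨this, rfl⟩)⟩
      by_cases i2 : i = v
      · right
        have : j = u := by
          rcases pv' j (i2 ▸ h) with h' | h'
          · exact h'
          · exact absurd (i2.trans h'.symm) hij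
        exact ⟨s, u, Or.inr (Or.inr ⟨i2, rfl⟩), Or.inr (Or.inr ⟨rfl, rfl⟩),
          Or.inr (Or.inl ⟨this, rfl⟩)⟩
      · left; right
        refine ⟨h, i1, i2, ?_, ?_⟩
        · rintro rfl
          rcases pu' i (α.iseqv.symm h) with h' | h'
          · exact i1 h'
          · exact i2 h'
        · rintro rfl
          rcases pv' i (α.iseqv.symm h) with h' | h'
          · exact i1 h'
          · exact i2 h'
    · intro i j h
      exact ⟨i, Or.inl ⟨rfl, ⟨j, h⟩⟩, h⟩
  rw [e]
  exact hX _ _ mβ mγ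

theorem step {k : ℕ} (hk : k + 3 ≤ n) {X : Set (Dgm n)} (hX : Closed X)
    (h1 : DM n (k + 1) ⊆ X) (h2 : DM n (k + 2) ⊆ X) : DM n k ⊆ X := by
  have s1 : ∀ X : Set (Dgm n), Closed X → DM n (k + 1) ⊆ X → DM n (k + 2) ⊆ X →
      ∀ α ∈ DM n k, LoTriv α → α ∈ X := by
    intro X hX h1 h2 α hα hL
    apply peel hk hX h1 h2 hα
    intro γ hγ hU hLγ
    exact poi_mem (by omega) hX h1 hγ hU (fun i j h => hL _ _ ((hLγ _ _).1 h))
  intro α hα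
  apply peel hk hX h1 h2 hα
  intro γ hγ hU _
  have : pstar γ ∈ dual X :=
    s1 _ (dual_closed hX) (dual_DM h1) (dual_DM h2) _ (pstar_DM hγ) hU
  have this : pstar (pstar γ) ∈ X := this
  rwa [pstar_pstar] at this

theorem gen_all {r : ℕ} (h1 : 1 ≤ r) (hn : r < n) {X : Set (Dgm n)} (hX : Closed X)
    (d1 : DM n r ⊆ X) (d2 : DM n (r - 1) ⊆ X) : ∀ d, ∀ k, k + d = r → DM n k ⊆ X := by
  intro d
  induction d using Nat.strong_induction_on with
  | _ d ih =>
  intro k hk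
  match d, ih, hk with
  | 0, _, hk => have : k = r := by omega
                rw [this]; exact d1
  | 1, _, hk => have : k = r - 1 := by omega
                rw [this]; exact d2
  | d + 2, ih, hk =>
    exact step (by omega) hX (ih (d + 1) (by omega) (k + 1) (by omega))
      (ih d (by omega) (k + 2) (by omega))

end Dgm

/-- For `1 ≤ r ≤ n - 1`, the ideal `I_r(M_n)` is generated
by its top two D-classes. -/
theorem IM_generated_by_top_two (n r : ℕ) (h1 : 1 ≤ r) (h2 : r < n) :
    IM n r = genSet (pmul (n := n)) (DM n r ∪ DM n (r - 1)) := by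
  ext α
  constructor
  · intro h
    refine gen_all h1 h2 (X := genSet (pmul (n := n)) (DM n r ∪ DM n (r - 1)))
      (fun a b ha hb => MClo.mul ha hb) (fun a ha => MClo.base (Or.inl ha))
      (fun a ha => MClo.base (Or.inr ha)) (r - prank α) (prank α) ?_ ⟨h.1, rfl⟩
    have : prank α ≤ r := h.2
    omega
  · intro h
    change MClo (pmul (n := n)) (DM n r ∪ DM n (r - 1)) α at h
    induction h with
    | base hb =>
      rcases hb with hb | hb
      · exact ⟨hb.1, hb.2.le⟩
      · exact ⟨hb.1, by rw [hb.2]; omega⟩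
    | mul _ _ i1 i2 => exact pmul_IM i1 i2
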